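/- arXiv:2404.12101 — 11 statements merged into one kernel-verified Lean document; each statement's English description precedes it below -/
import Mathlib

section
/- Let 𝔥 be a Lie algebra and 𝔪 a vector space over the same field, equipped with linear maps ▷: 𝔥⊗𝔪→𝔪, [[·,·]]: 𝔪⊗𝔪→𝔪, θ: 𝔪⊗𝔪→𝔥 and ψ: 𝔥⊗𝔪→𝔥 such that ▷ makes 𝔪 a left 𝔥-module and conditions (L1)–(L6) hold. Then the direct sum 𝔪⊕𝔥 equipped with the bracket [(v₁,η₁),(v₂,η₂)] = ([[v₁,v₂]] + η₁▷v₂ − η₂▷v₁, [η₁,η₂] + ψ(η₁,v₂) − ψ(η₂,v₁) + θ(v₁,v₂)) is a Lie algebra (the cocycle double cross sum, or unified product, 𝔪⋈_θ𝔥). -/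
/-- The cocycle double cross sum (unified product) 𝔪⋈_θ𝔥:
given a Lie algebra 𝔥 acting on a vector space 𝔪, together with linear maps
[[·,·]] : 𝔪⊗𝔪→𝔪, θ : 𝔪⊗𝔪→𝔥, ψ : 𝔥⊗𝔪→𝔥 satisfying (L1)–(L6), the direct sum
𝔪⊕𝔥 with the indicated bracket is a Lie algebra (bilinear, alternating,
satisfying the Jacobi identity). -/
theorem cocycle_double_cross_sum_is_lie_algebra
    {K : Type*} [Field K] [CharZero K]
    {H : Type*} [LieRing H] [LieAlgebra K H]
    {M : Type*} [AddCommGroup M] [Module K M]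
    (act : H →ₗ[K] M →ₗ[K] M)
    (mbr : M →ₗ[K] M →ₗ[K] M)
    (θ : M →ₗ[K] M →ₗ[K] H)
    (ψ : H →ₗ[K] M →ₗ[K] H)
    (hact : ∀ (η₁ η₂ : H) (v : M),
      act ⁅η₁, η₂⁆ v = act η₁ (act η₂ v) - act η₂ (act η₁ v))
    (hL1 : ∀ v : M, mbr v v = 0 ∧ θ v v = 0)
    (hL2 : ∀ (η : H) (v₁ v₂ : M),
      act η (mbr v₁ v₂) = mbr (act η v₁) v₂ + mbr v₁ (act η v₂)
        + act (ψ η v₁) v₂ - act (ψ η v₂) v₁)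
    (hL3 : ∀ (η : H) (v₁ v₂ : M),
      ⁅η, θ v₁ v₂⁆ = θ (act η v₁) v₂ + θ v₁ (act η v₂)
        + ψ (ψ η v₁) v₂ - ψ (ψ η v₂) v₁ - ψ η (mbr v₁ v₂))
    (hL4 : ∀ (η₁ η₂ : H) (v : M),
      ψ ⁅η₁, η₂⁆ v = ⁅η₁, ψ η₂ v⁆ + ⁅ψ η₁ v, η₂⁆
        + ψ η₁ (act η₂ v) - ψ η₂ (act η₁ v))
    (hL5 : ∀ v₁ v₂ v₃ : M,
      (mbr (mbr v₁ v₂) v₃ + mbr (mbr v₂ v₃) v₁ + mbr (mbr v₃ v₁) v₂)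
        + (act (θ v₁ v₂) v₃ + act (θ v₂ v₃) v₁ + act (θ v₃ v₁) v₂) = 0)
    (hL6 : ∀ v₁ v₂ v₃ : M,
      (ψ (θ v₁ v₂) v₃ + ψ (θ v₂ v₃) v₁ + ψ (θ v₃ v₁) v₂)
        + (θ (mbr v₁ v₂) v₃ + θ (mbr v₂ v₃) v₁ + θ (mbr v₃ v₁) v₂) = 0) :
    let B : (M × H) → (M × H) → (M × H) := fun p q =>
      (mbr p.1 q.1 + act p.2 q.1 - act q.2 p.1,
        ⁅p.2, q.2⁆ + ψ p.2 q.1 - ψ q.2 p.1 + θ p.1 q.1)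
    (∀ (a : K) (x y z : M × H),
        B (x + y) z = B x z + B y z ∧ B x (y + z) = B x y + B x z ∧
        B (a • x) y = a • B x y ∧ B x (a • y) = a • B x y) ∧
    (∀ x : M × H, B x x = 0) ∧
    (∀ x y z : M × H, B x (B y z) + B y (B z x) + B z (B x y) = 0) := by
  have mbr_skew (u v : M) : mbr u v = -mbr v u :=
    (LinearMap.IsAlt.neg (B := mbr) (fun v => (hL1 v).1) v u).symm
  have θ_skew (u v : M) : θ u v = -θ v u :=
    (LinearMap.IsAlt.neg (B := θ) (fun v => (hL1 v).2) v u).symm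
  have mbr_act (u : M) (η : H) (v : M) := mbr_skew u (act η v)
  have mbr_mbr (u v w : M) := mbr_skew u (mbr v w)
  have θ_act (u : M) (η : H) (v : M) := θ_skew u (act η v)
  have θ_mbr (u v w : M) := θ_skew u (mbr v w)
  have lie_ψ (η₁ η₂ : H) (v : M) : ⁅η₁, ψ η₂ v⁆ = -⁅ψ η₂ v, η₁⁆ := (lie_skew _ _).symm
  intro B
  refine ⟨?_, ?_, ?_⟩
  · rintro a ⟨u, p⟩ ⟨v, q⟩ ⟨w, r⟩
    refine ⟨?_, ?_, ?_, ?_⟩ <;> ext <;>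
      simp only [B, Prod.fst_add, Prod.snd_add, Prod.smul_fst, Prod.smul_snd, map_add, map_smul,
        LinearMap.add_apply, LinearMap.smul_apply, add_lie, lie_add, smul_lie, lie_smul,
        smul_add, smul_sub] <;> abel
  · rintro ⟨v, η⟩
    ext <;> simp [B, hL1]
  · rintro ⟨u, p⟩ ⟨v, q⟩ ⟨w, r⟩
    ext
    · have h := hL5 u v w
      simp only [B, Prod.fst_add, Prod.fst_zero, map_add, map_sub, LinearMap.add_apply,
        LinearMap.sub_apply, mbr_act, mbr_mbr, hL2, hact]
      rw [← neg_eq_zero, ← h]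
      abel
    · have h := hL6 u v w
      have jac := lie_jacobi p q r
      simp only [B, Prod.snd_add, Prod.snd_zero, map_add, map_sub, LinearMap.add_apply,
        LinearMap.sub_apply, lie_add, lie_sub, θ_act, θ_mbr, hL3, hL4, lie_ψ]
      rw [← sub_eq_zero.mpr (jac.trans h.symm)]
      abel
end

section
/- Let 𝔥 be a Lie algebra and 𝔪 a vector space over the same field, equipped with linear maps ▷: 𝔥⊗𝔪→𝔪 making 𝔪 a left 𝔥-module, and [[·,·]]: 𝔪⊗𝔪→𝔪, θ: 𝔪⊗𝔪→𝔥, ψ: 𝔥⊗𝔪→𝔥. If the bracket [(v₁,η₁),(v₂,η₂)] = ([[v₁,v₂]] + η₁▷v₂ − η₂▷v₁, [η₁,η₂] + ψ(η₁,v₂) − ψ(η₂,v₁) + θ(v₁,v₂)) on 𝔪⊕𝔥 is a Lie bracket (antisymmetric and satisfying the Jacobi identity), then conditions (L1)–(L6) hold. -/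
/-- Converse of the unified product construction: if the bracket
[(v₁,η₁),(v₂,η₂)] = ([[v₁,v₂]] + η₁▷v₂ − η₂▷v₁,
                     [η₁,η₂] + ψ(η₁,v₂) − ψ(η₂,v₁) + θ(v₁,v₂))
on 𝔪⊕𝔥 is a Lie bracket (antisymmetric and satisfying the Jacobi identity),
then conditions (L1)–(L6) hold. -/
theorem cocycle_double_cross_sum_conditions_of_lie_bracket
    {K : Type*} [Field K] [CharZero K]
    {H : Type*} [LieRing H] [LieAlgebra K H]
    {M : Type*} [AddCommGroup M] [Module K M]
    (act : H →ₗ[K] M →ₗ[K] M)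
    (mbr : M →ₗ[K] M →ₗ[K] M)
    (θ : M →ₗ[K] M →ₗ[K] H)
    (ψ : H →ₗ[K] M →ₗ[K] H)
    (hact : ∀ (η₁ η₂ : H) (v : M),
      act ⁅η₁, η₂⁆ v = act η₁ (act η₂ v) - act η₂ (act η₁ v))
    (B : (M × H) → (M × H) → (M × H))
    (hB : ∀ p q : M × H, B p q =
      (mbr p.1 q.1 + act p.2 q.1 - act q.2 p.1,
        ⁅p.2, q.2⁆ + ψ p.2 q.1 - ψ q.2 p.1 + θ p.1 q.1))
    (hanti : ∀ x y : M × H, B x y = - B y x)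
    (hjacobi : ∀ x y z : M × H, B x (B y z) + B y (B z x) + B z (B x y) = 0) :
    (∀ v : M, mbr v v = 0 ∧ θ v v = 0) ∧
    (∀ (η : H) (v₁ v₂ : M),
      act η (mbr v₁ v₂) = mbr (act η v₁) v₂ + mbr v₁ (act η v₂)
        + act (ψ η v₁) v₂ - act (ψ η v₂) v₁) ∧
    (∀ (η : H) (v₁ v₂ : M),
      ⁅η, θ v₁ v₂⁆ = θ (act η v₁) v₂ + θ v₁ (act η v₂)
        + ψ (ψ η v₁) v₂ - ψ (ψ η v₂) v₁ - ψ η (mbr v₁ v₂)) ∧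
    (∀ (η₁ η₂ : H) (v : M),
      ψ ⁅η₁, η₂⁆ v = ⁅η₁, ψ η₂ v⁆ + ⁅ψ η₁ v, η₂⁆
        + ψ η₁ (act η₂ v) - ψ η₂ (act η₁ v)) ∧
    (∀ v₁ v₂ v₃ : M,
      (mbr (mbr v₁ v₂) v₃ + mbr (mbr v₂ v₃) v₁ + mbr (mbr v₃ v₁) v₂)
        + (act (θ v₁ v₂) v₃ + act (θ v₂ v₃) v₁ + act (θ v₃ v₁) v₂) = 0) ∧
    (∀ v₁ v₂ v₃ : M,
      (ψ (θ v₁ v₂) v₃ + ψ (θ v₂ v₃) v₁ + ψ (θ v₃ v₁) v₂)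
        + (θ (mbr v₁ v₂) v₃ + θ (mbr v₂ v₃) v₁ + θ (mbr v₃ v₁) v₂) = 0) := by
  have skew : ∀ u v : M, mbr u v = -mbr v u ∧ θ u v = -θ v u := fun u v => by
    simpa [hB] using hanti (u, 0) (v, 0)
  have mbr_skew u v := (skew u v).1
  have theta_skew u v := (skew u v).2
  have hηvv := fun (η : H) (v₁ v₂ : M) => hjacobi (0, η) (v₁, 0) (v₂, 0)
  have hηηv := fun (η₁ η₂ : H) (v : M) => hjacobi (0, η₁) (0, η₂) (v, 0)
  have hvvv := fun v₁ v₂ v₃ : M => hjacobi (v₁, 0) (v₂, 0) (v₃, 0)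
  simp [hB] at hηvv hηηv hvvv
  refine ⟨fun v => ⟨?_, ?_⟩, fun η v₁ v₂ => ?_, fun η v₁ v₂ => ?_, fun η₁ η₂ v => ?_,
    fun v₁ v₂ v₃ => ?_, fun v₁ v₂ v₃ => ?_⟩
  · have : IsAddTorsionFree M := .of_isTorsionFree K M
    exact self_eq_neg.mp (mbr_skew v v)
  · have : IsAddTorsionFree H := .of_isTorsionFree K H
    exact self_eq_neg.mp (theta_skew v v)
  · rw [mbr_skew (act η v₁) v₂, ← sub_eq_zero, ← (hηvv η v₁ v₂).1]
    abel
  · rw [theta_skew (act η v₁) v₂, ← sub_eq_zero, ← (hηvv η v₁ v₂).2]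
    abel
  · rw [eq_comm, ← sub_eq_zero, ← (hηηv η₁ η₂ v).2]
    abel
  · rw [mbr_skew (mbr v₁ v₂), mbr_skew (mbr v₂ v₃), mbr_skew (mbr v₃ v₁), ← neg_eq_zero, ← (hvvv v₁ v₂ v₃).1]
    abel
  · rw [theta_skew (mbr v₁ v₂), theta_skew (mbr v₂ v₃), theta_skew (mbr v₃ v₁),
      ← neg_eq_zero, ← (hvvv v₁ v₂ v₃).2]
    abel
end

section
/- Let 𝔤 be a Lie algebra, 𝔥 ⊆ 𝔤 a Lie subalgebra, and 𝔪 ⊆ 𝔤 a vector subspace with 𝔤 = 𝔪 ⊕ 𝔥 as vector spaces; let p: 𝔤→𝔪 and q: 𝔤→𝔥 be the associated projections. Define η▷v := p([η,v]), ψ(η,v) := q([η,v]), [[v₁,v₂]] := p([v₁,v₂]) and θ(v₁,v₂) := q([v₁,v₂]) for v,v₁,v₂∈𝔪, η∈𝔥. Then ▷ is a Lie algebra action of 𝔥 on 𝔪, the maps satisfy conditions (L1)–(L6), and for all v₁,v₂∈𝔪 and η₁,η₂∈𝔥 one has [v₁+η₁, v₂+η₂] = ([[v₁,v₂]] + η₁▷v₂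 − η₂▷v₁) + ([η₁,η₂] + ψ(η₁,v₂) − ψ(η₂,v₁) + θ(v₁,v₂)) in 𝔤; that is, 𝔤 is the cocycle double cross sum 𝔪⋈_θ𝔥. -/
/-- Any Lie algebra 𝔤 with a subalgebra 𝔥 and a complementary
subspace 𝔪 (with projections p, q) is a cocycle double cross sum 𝔪⋈_θ𝔥:
the maps η▷v := p[η,v], ψ(η,v) := q[η,v], [[v₁,v₂]] := p[v₁,v₂],
θ(v₁,v₂) := q[v₁,v₂] make ▷ a Lie algebra action, satisfy (L1)–(L6), and the
bracket of 𝔤 decomposes accordingly. -/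
theorem subalgebra_complement_is_cocycle_double_cross_sum
    {K : Type*} [Field K] [CharZero K]
    {G : Type*} [LieRing G] [LieAlgebra K G]
    (𝔥 : LieSubalgebra K G) (𝔪 : Submodule K G)
    (hcompl : IsCompl 𝔪 𝔥.toSubmodule)
    (p q : G →ₗ[K] G)
    (hp : ∀ x : G, p x ∈ 𝔪) (hq : ∀ x : G, q x ∈ 𝔥)
    (hpq : ∀ x : G, p x + q x = x) :
    let D : G → G → G := fun η v => p ⁅η, v⁆
    let Ψ : G → G → G := fun η v => q ⁅η, v⁆
    let Bm : G → G → G := fun v w => p ⁅v, w⁆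
    let Θ : G → G → G := fun v w => q ⁅v, w⁆
    -- ▷ is a Lie algebra action of 𝔥 on 𝔪
    (∀ η₁ ∈ 𝔥, ∀ η₂ ∈ 𝔥, ∀ v ∈ 𝔪,
      D ⁅η₁, η₂⁆ v = D η₁ (D η₂ v) - D η₂ (D η₁ v)) ∧
    -- (L1)
    (∀ v ∈ 𝔪, Bm v v = 0 ∧ Θ v v = 0) ∧
    -- (L2)
    (∀ η ∈ 𝔥, ∀ v₁ ∈ 𝔪, ∀ v₂ ∈ 𝔪,
      D η (Bm v₁ v₂) = Bm (D η v₁) v₂ + Bm v₁ (D η v₂)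
        + D (Ψ η v₁) v₂ - D (Ψ η v₂) v₁) ∧
    -- (L3)
    (∀ η ∈ 𝔥, ∀ v₁ ∈ 𝔪, ∀ v₂ ∈ 𝔪,
      ⁅η, Θ v₁ v₂⁆ = Θ (D η v₁) v₂ + Θ v₁ (D η v₂)
        + Ψ (Ψ η v₁) v₂ - Ψ (Ψ η v₂) v₁ - Ψ η (Bm v₁ v₂)) ∧
    -- (L4)
    (∀ η₁ ∈ 𝔥, ∀ η₂ ∈ 𝔥, ∀ v ∈ 𝔪,
      Ψ ⁅η₁, η₂⁆ v = ⁅η₁, Ψ η₂ v⁆ + ⁅Ψ η₁ v, η₂⁆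
        + Ψ η₁ (D η₂ v) - Ψ η₂ (D η₁ v)) ∧
    -- (L5)
    (∀ v₁ ∈ 𝔪, ∀ v₂ ∈ 𝔪, ∀ v₃ ∈ 𝔪,
      (Bm (Bm v₁ v₂) v₃ + Bm (Bm v₂ v₃) v₁ + Bm (Bm v₃ v₁) v₂)
        + (D (Θ v₁ v₂) v₃ + D (Θ v₂ v₃) v₁ + D (Θ v₃ v₁) v₂) = 0) ∧
    -- (L6)
    (∀ v₁ ∈ 𝔪, ∀ v₂ ∈ 𝔪, ∀ v₃ ∈ 𝔪,
      (Ψ (Θ v₁ v₂) v₃ + Ψ (Θ v₂ v₃) v₁ + Ψ (Θ v₃ v₁) v₂)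
        + (Θ (Bm v₁ v₂) v₃ + Θ (Bm v₂ v₃) v₁ + Θ (Bm v₃ v₁) v₂) = 0) ∧
    -- the bracket of 𝔤 is the cocycle double cross sum bracket
    (∀ v₁ ∈ 𝔪, ∀ v₂ ∈ 𝔪, ∀ η₁ ∈ 𝔥, ∀ η₂ ∈ 𝔥,
      ⁅v₁ + η₁, v₂ + η₂⁆
        = (Bm v₁ v₂ + D η₁ v₂ - D η₂ v₁)
          + (⁅η₁, η₂⁆ + Ψ η₁ v₂ - Ψ η₂ v₁ + Θ v₁ v₂)) := by
  intro D Ψ Bm Θ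
  have hp0 : ∀ x ∈ 𝔥, p x = 0 := fun x hx =>
    Submodule.disjoint_def.mp hcompl.disjoint _ (hp x)
      (by rw [eq_sub_of_add_eq (hpq x)]; exact sub_mem hx (hq x))
  have hq1 : ∀ x ∈ 𝔥, q x = x := fun x hx => by
    simpa [hp0 x hx] using hpq x
  have split_right : ∀ (f : G →ₗ[K] G) (x y : G), f ⁅x, y⁆ = f ⁅x, p y⁆ + f ⁅x, q y⁆ :=
    fun f x y => by rw [← map_add, ← lie_add, hpq]
  have split_left : ∀ (f : G →ₗ[K] G) (x y : G), f ⁅x, y⁆ = f ⁅p x, y⁆ + f ⁅q x, y⁆ :=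
    fun f x y => by rw [← map_add, ← add_lie, hpq]
  have skew : ∀ (f : G →ₗ[K] G) (x y : G), f ⁅x, y⁆ = - f ⁅y, x⁆ :=
    fun f x y => by rw [← map_neg, lie_skew]
  have leibniz : ∀ (f : G →ₗ[K] G) (x y z : G),
      f ⁅x, ⁅y, z⁆⁆ = f ⁅⁅x, y⁆, z⁆ + f ⁅y, ⁅x, z⁆⁆ :=
    fun f x y z => by rw [leibniz_lie, map_add]
  have lie_lie_split : ∀ (f : G →ₗ[K] G) (x y z : G),
      f ⁅⁅x, y⁆, z⁆ = f ⁅x, p ⁅y, z⁆⁆ + f ⁅x, q ⁅y, z⁆⁆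
        - (f ⁅y, p ⁅x, z⁆⁆ + f ⁅y, q ⁅x, z⁆⁆) :=
    fun f x y z => by rw [lie_lie, map_sub, ← split_right, ← split_right]
  have derivation_split : ∀ (f : G →ₗ[K] G) (x y z : G),
      f ⁅x, p ⁅y, z⁆⁆ + f ⁅x, q ⁅y, z⁆⁆ = f ⁅p ⁅x, y⁆, z⁆ + f ⁅q ⁅x, y⁆, z⁆
        + (f ⁅y, p ⁅x, z⁆⁆ - f ⁅q ⁅x, z⁆, y⁆) :=
    fun f x y z => by
      rw [← split_right, ← split_left, sub_eq_add_neg, ← skew f y, ← split_right, leibniz]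
  have jacobi_split : ∀ (f : G →ₗ[K] G) (x y z : G),
      (f ⁅p ⁅x, y⁆, z⁆ + f ⁅q ⁅x, y⁆, z⁆) + (f ⁅p ⁅y, z⁆, x⁆ + f ⁅q ⁅y, z⁆, x⁆)
        + (f ⁅p ⁅z, x⁆, y⁆ + f ⁅q ⁅z, x⁆, y⁆) = 0 :=
    fun f x y z => by
      rw [← split_left, ← split_left, ← split_left, ← map_add, ← map_add,
        ← lie_skew ⁅x, y⁆ z, ← lie_skew ⁅y, z⁆ x, ← lie_skew ⁅z, x⁆ y, ← neg_add, ← neg_add,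
        add_rotate, lie_jacobi, neg_zero, map_zero]
  refine ⟨?_, ?_, ?_, ?_, ?_, ?_, ?_, ?_⟩ <;> dsimp only [D, Ψ, Bm, Θ]
  · intro η₁ h₁ η₂ h₂ v _
    rw [lie_lie_split, hp0 _ (𝔥.lie_mem h₁ (hq _)), hp0 _ (𝔥.lie_mem h₂ (hq _))]
    abel
  · intro v _
    simp
  · intro η h v₁ _ v₂ _
    have := derivation_split p η v₁ v₂
    rw [hp0 _ (𝔥.lie_mem h (hq _)), add_zero] at this
    rw [this]
    abel
  · intro η h v₁ _ v₂ _
    have := derivation_split q η v₁ v₂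
    rw [hq1 _ (𝔥.lie_mem h (hq _))] at this
    rw [eq_sub_of_add_eq' this]
    abel
  · intro η₁ h₁ η₂ h₂ v _
    rw [lie_lie_split, hq1 _ (𝔥.lie_mem h₁ (hq _)), hq1 _ (𝔥.lie_mem h₂ (hq _)),
      ← lie_skew η₂ (q ⁅η₁, v⁆)]
    abel
  · intro v₁ _ v₂ _ v₃ _
    rw [← jacobi_split p v₁ v₂ v₃]
    abel
  · intro v₁ _ v₂ _ v₃ _
    rw [← jacobi_split q v₁ v₂ v₃]
    abel
  · intro v₁ _ v₂ _ η₁ _ η₂ _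
    have expand : ⁅v₁ + η₁, v₂ + η₂⁆ = ⁅v₁, v₂⁆ + ⁅η₁, v₂⁆ - ⁅η₂, v₁⁆ + ⁅η₁, η₂⁆ := by
      rw [add_lie, lie_add, lie_add, ← lie_skew η₂ v₁]
      abel
    rw [expand]
    nth_rw 1 [← hpq ⁅v₁, v₂⁆, ← hpq ⁅η₁, v₂⁆, ← hpq ⁅η₂, v₁⁆]
    abel
end

section
/- Let G be a group, H ≤ G a subgroup, and M ⊆ G a subset containing the identity 1, such that the multiplication map M×H → G, (m,h) ↦ mh, is a bijection. For h∈H and m,m₁,m₂∈M define h▷m ∈ M and σ(h,m) ∈ H by the unique factorization hm = (h▷m)σ(h,m), and define m₁·m₂ ∈ M and γ(m₁,m₂) ∈ H by the unique factorization m₁m₂ = (m₁·m₂)γ(m₁,m₂). Then these maps (with distinguished element o = 1 ∈ M) satisfy the normalizations (G0) and conditions (G1)–(G8) of a cocycle matched pair, and the bijection M×H → G is a group isomorphism when M×H is equipped with the multiplication (m₁,h₁)(m₂,h₂) = (m₁·(h₁▷m₂), γ(m₁, h₁▷m₂)·σ(h₁,m₂)·h₂); i.e. G is a cocycle double cross product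 of (M,H). -/
/-- If G is a group, H ≤ G a subgroup and M ⊆ G a subset with
1 ∈ M such that (m,h) ↦ mh is a bijection M×H → G, then the maps obtained
from the unique factorizations hm = (h▷m)σ(h,m) and m₁m₂ = (m₁·m₂)γ(m₁,m₂)
form a cocycle matched pair (normalizations (G0) and conditions (G1)–(G8),
with o = 1), and (m,h) ↦ mh is a group isomorphism from the cocycle double
cross product M⋈_γH to G. -/
theorem group_with_factorization_is_cocycle_double_cross_product
    {G : Type*} [Group G] (H : Subgroup G) (M : Set G) (h1M : (1 : G) ∈ M)
    (hfact : ∀ g : G, ∃! p : M × H, (p.1 : G) * (p.2 : G) = g) :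
    ∃ (act : H → M → M) (σ : H → M → H) (mulM : M → M → M) (γ : M → M → H),
      -- defining factorizations
      (∀ (h : H) (m : M), (h : G) * (m : G) = (act h m : G) * ((σ h m : H) : G)) ∧
      (∀ m₁ m₂ : M, (m₁ : G) * (m₂ : G) = (mulM m₁ m₂ : G) * ((γ m₁ m₂ : H) : G)) ∧
      -- (G0) normalizations, with o = ⟨1, h1M⟩
      (∀ m, act 1 m = m) ∧
      (∀ h, act h ⟨1, h1M⟩ = ⟨1, h1M⟩) ∧
      (∀ h, σ h ⟨1, h1M⟩ = h) ∧
      (∀ m, σ 1 m = 1) ∧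
      (γ ⟨1, h1M⟩ ⟨1, h1M⟩ = 1) ∧
      -- (G1)
      (∀ m, mulM ⟨1, h1M⟩ m = m ∧ mulM m ⟨1, h1M⟩ = m) ∧
      -- (G2)
      (∀ m, γ m ⟨1, h1M⟩ = 1 ∧ γ ⟨1, h1M⟩ m = 1) ∧
      -- (G3)
      (∀ h m₁ m₂, act h (mulM m₁ m₂) = mulM (act h m₁) (act (σ h m₁) m₂)) ∧
      -- (G4)
      (∀ h m₁ m₂, σ h (mulM m₁ m₂) * γ m₁ m₂
        = γ (act h m₁) (act (σ h m₁) m₂) * σ (σ h m₁) m₂) ∧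
      -- (G5)
      (∀ h₁ h₂ m, σ (h₁ * h₂) m = σ h₁ (act h₂ m) * σ h₂ m) ∧
      -- (G6)
      (∀ m₁ m₂ m₃, mulM m₁ (mulM m₂ m₃)
        = mulM (mulM m₁ m₂) (act (γ m₁ m₂) m₃)) ∧
      -- (G7)
      (∀ m₁ m₂ m₃, γ m₁ (mulM m₂ m₃) * γ m₂ m₃
        = γ (mulM m₁ m₂) (act (γ m₁ m₂) m₃) * σ (γ m₁ m₂) m₃) ∧
      -- (G8)
      (∀ m, ∃ mr, mulM m mr = (⟨1, h1M⟩ : M)) ∧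
      -- (m,h) ↦ mh intertwines the unified product multiplication with that of G
      (∀ (m₁ m₂ : M) (h₁ h₂ : H),
        ((m₁ : G) * (h₁ : G)) * ((m₂ : G) * (h₂ : G))
          = (mulM m₁ (act h₁ m₂) : G)
            * ((γ m₁ (act h₁ m₂) * σ h₁ m₂ * h₂ : H) : G)) := by
  have uniq : ∀ {m m' : M} {h h' : H}, (m : G) * (h : G) = m' * h' → m = m' ∧ h = h' :=
    fun {m m' h h'} e => Prod.ext_iff.mp <|
      (hfact (m' * h')).unique (y₁ := (m, h)) (y₂ := (m', h')) e rfl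
  choose f hf using fun g => (hfact g).exists
  let act : H → M → M := fun h m => (f (h * m)).1
  let σ : H → M → H := fun h m => (f (h * m)).2
  let mulM : M → M → M := fun m₁ m₂ => (f (m₁ * m₂)).1
  let γ : M → M → H := fun m₁ m₂ => (f (m₁ * m₂)).2
  have hact : ∀ (h : H) (m : M), (h : G) * m = act h m * σ h m := fun h m => (hf _).symm
  have hmul : ∀ m₁ m₂ : M, (m₁ : G) * m₂ = mulM m₁ m₂ * γ m₁ m₂ := fun m₁ m₂ => (hf _).symm
  clear_value act σ mulM γ
  have act_one : ∀ m, act 1 m = m ∧ σ 1 m = 1 := fun m => uniq (by rw [← hact]; simp)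
  have act_o : ∀ h, act h ⟨1, h1M⟩ = ⟨1, h1M⟩ ∧ σ h ⟨1, h1M⟩ = h :=
    fun h => uniq (by rw [← hact]; simp)
  have o_mul : ∀ m, mulM ⟨1, h1M⟩ m = m ∧ γ ⟨1, h1M⟩ m = 1 :=
    fun m => uniq (by rw [← hmul]; simp)
  have mul_o : ∀ m, mulM m ⟨1, h1M⟩ = m ∧ γ m ⟨1, h1M⟩ = 1 :=
    fun m => uniq (by rw [← hmul]; simp)
  have act_mul : ∀ h m₁ m₂, act h (mulM m₁ m₂) = mulM (act h m₁) (act (σ h m₁) m₂) ∧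
      σ h (mulM m₁ m₂) * γ m₁ m₂ =
        γ (act h m₁) (act (σ h m₁) m₂) * σ (σ h m₁) m₂ := fun h m₁ m₂ => uniq <| by
    simp only [Subgroup.coe_mul]
    rw [← mul_assoc, ← hact, mul_assoc, ← hmul, ← mul_assoc, ← mul_assoc, ← hmul, mul_assoc,
      mul_assoc, ← hact, ← mul_assoc, ← mul_assoc, ← hact]
  have mul_act : ∀ h₁ h₂ m, act (h₁ * h₂) m = act h₁ (act h₂ m) ∧
      σ (h₁ * h₂) m = σ h₁ (act h₂ m) * σ h₂ m := fun h₁ h₂ m => uniq <| by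
    rw [← hact, Subgroup.coe_mul, Subgroup.coe_mul, ← mul_assoc, ← hact, mul_assoc, mul_assoc,
      ← hact]
  have assoc : ∀ m₁ m₂ m₃, mulM m₁ (mulM m₂ m₃) = mulM (mulM m₁ m₂) (act (γ m₁ m₂) m₃) ∧
      γ m₁ (mulM m₂ m₃) * γ m₂ m₃ =
        γ (mulM m₁ m₂) (act (γ m₁ m₂) m₃) * σ (γ m₁ m₂) m₃ := fun m₁ m₂ m₃ => uniq <| by
    simp only [Subgroup.coe_mul]
    rw [← mul_assoc, ← hmul, mul_assoc, ← hmul, ← mul_assoc, ← mul_assoc, ← hmul, mul_assoc,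
      mul_assoc, ← hact, ← mul_assoc, ← mul_assoc, ← hmul]
  refine ⟨act, σ, mulM, γ, hact, hmul, fun m => (act_one m).1, fun h => (act_o h).1,
    fun h => (act_o h).2, fun m => (act_one m).2, (o_mul _).2,
    fun m => ⟨(o_mul m).1, (mul_o m).1⟩, fun m => ⟨(mul_o m).2, (o_mul m).2⟩,
    fun h m₁ m₂ => (act_mul h m₁ m₂).1, fun h m₁ m₂ => (act_mul h m₁ m₂).2,
    fun h₁ h₂ m => (mul_act h₁ h₂ m).2, fun m₁ m₂ m₃ => (assoc m₁ m₂ m₃).1,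
    fun m₁ m₂ m₃ => (assoc m₁ m₂ m₃).2, fun m => ?_, fun m₁ m₂ h₁ h₂ => ?_⟩
  · refine ⟨(f (m : G)⁻¹).1, (uniq (h := γ m (f (m : G)⁻¹).1) (h' := (f (m : G)⁻¹).2⁻¹) ?_).1⟩
    rw [← hmul, Subgroup.coe_inv, one_mul, eq_inv_iff_mul_eq_one, mul_assoc, hf, mul_inv_cancel]
  · simp only [Subgroup.coe_mul]
    rw [← mul_assoc, ← mul_assoc, ← mul_assoc, ← hmul, mul_assoc (m₁ : G) (act h₁ m₂ : G), ← hact]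
    simp only [mul_assoc]
end

section
/- Let G be a group acting on a real Lie algebra 𝔤 by Lie algebra automorphisms, g ↦ Ad_g. Define φ: (G×𝔤)×(G×𝔤) → 𝔤 by φ((g₁,ξ₁),(g₂,ξ₂)) = −ad_{ξ₂}Ad_{g₂⁻¹}ξ₁. Then φ is a group 2-cocycle on the semidirect product TG = G⋉𝔤 (with multiplication (g₁,ξ₁)(g₂,ξ₂) = (g₁g₂, ξ₂ + Ad_{g₂⁻¹}ξ₁)) with values in 𝔤, where (g,ξ) ∈ TG acts on 𝔤 by ζ ↦ Ad_{g⁻¹}ζ; that is, for all a,b,c ∈ TG with c = (g₃,ξ₃): Ad_{g₃⁻¹}φ(a,b) + φ(ab,c) = φ(a,bc) + φ(b,c). Consequently T²G is the 2-cocycle extension TG⋉_φ𝔤. -/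
/-- φ((g₁,ξ₁),(g₂,ξ₂)) = −ad_{ξ₂}Ad_{g₂⁻¹}ξ₁ is a group 2-cocycle
on TG = G⋉𝔤 with values in 𝔤 (with (g,ξ) acting by Ad_{g⁻¹}):
Ad_{g₃⁻¹}φ(a,b) + φ(ab,c) = φ(a,bc) + φ(b,c), and consequently the T²G
multiplication is the 2-cocycle extension multiplication of TG⋉_φ𝔤. -/
theorem T2G_is_two_cocycle_extension_of_TG
    {G : Type*} [Group G] {L : Type*} [LieRing L] [LieAlgebra ℝ L]
    (Ad : G → L →ₗ[ℝ] L)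
    (hAd_mul : ∀ x y : G, Ad (x * y) = (Ad x).comp (Ad y))
    (hAd_one : Ad 1 = LinearMap.id)
    (hAd_br : ∀ (x : G) (ξ ζ : L), Ad x ⁅ξ, ζ⁆ = ⁅Ad x ξ, Ad x ζ⁆) :
    let φ : G × L → G × L → L := fun a b => -⁅b.2, Ad b.1⁻¹ a.2⁆
    let mulTG : G × L → G × L → G × L := fun a b =>
      (a.1 * b.1, b.2 + Ad b.1⁻¹ a.2)
    let mul2 : G × L × L → G × L × L → G × L × L := fun a b =>
      (a.1 * b.1, b.2.1 + Ad b.1⁻¹ a.2.1,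
        b.2.2 + Ad b.1⁻¹ a.2.2 - ⁅b.2.1, Ad b.1⁻¹ a.2.1⁆)
    -- the 2-cocycle identity
    (∀ a b c : G × L,
      Ad c.1⁻¹ (φ a b) + φ (mulTG a b) c = φ a (mulTG b c) + φ b c) ∧
    -- T²G is the 2-cocycle extension TG⋉_φ𝔤
    (∀ (a b : G × L) (ζ₁ ζ₂ : L),
      mul2 (a.1, a.2, ζ₁) (b.1, b.2, ζ₂)
        = ((mulTG a b).1, (mulTG a b).2, ζ₂ + Ad b.1⁻¹ ζ₁ + φ a b)) := by
  refine ⟨fun a b c => ?_, fun a b ζ₁ ζ₂ => ?_⟩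
  · simp only [mul_inv_rev, hAd_mul, LinearMap.comp_apply, map_neg, map_add, hAd_br, lie_add,
      add_lie]
    abel
  · simp only [sub_eq_add_neg]
end

section
/- Let G be a group acting on a real Lie algebra 𝔤 by Lie algebra automorphisms, g ↦ Ad_g. Then the set G×𝔤×𝔤×𝔤 is a group under the multiplication (x,ξ₁,ξ₂,ξ₃)(y,ζ₁,ζ₂,ζ₃) = (xy, ζ₁ + Ad_{y⁻¹}ξ₁, ζ₂ + Ad_{y⁻¹}ξ₂ − ad_{ζ₁}Ad_{y⁻¹}ξ₁, ζ₃ + Ad_{y⁻¹}ξ₃ − 2ad_{ζ₁}Ad_{y⁻¹}ξ₂ − ad_{ζ₂}Ad_{y⁻¹}ξ₁ + ad²_{ζ₁}Ad_{y⁻¹}ξ₁), with unit (e,0,0,0). (This is the left-trivialized third order tangent group T³G.) -/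
/-- For a group G acting on a real Lie algebra 𝔤 by Lie algebra
automorphisms, the set G×𝔤×𝔤×𝔤 is a group under the left-trivialized third
order tangent group multiplication, with unit (e,0,0,0). -/
theorem third_order_tangent_group_is_group
    {G : Type*} [Group G] {L : Type*} [LieRing L] [LieAlgebra ℝ L]
    (Ad : G → L →ₗ[ℝ] L)
    (hAd_mul : ∀ x y : G, Ad (x * y) = (Ad x).comp (Ad y))
    (hAd_one : Ad 1 = LinearMap.id)
    (hAd_br : ∀ (x : G) (ξ ζ : L), Ad x ⁅ξ, ζ⁆ = ⁅Ad x ξ, Ad x ζ⁆) :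
    let mul3 : G × L × L × L → G × L × L × L → G × L × L × L := fun a b =>
      match a, b with
      | (x, ξ₁, ξ₂, ξ₃), (y, ζ₁, ζ₂, ζ₃) =>
        (x * y,
          ζ₁ + Ad y⁻¹ ξ₁,
          ζ₂ + Ad y⁻¹ ξ₂ - ⁅ζ₁, Ad y⁻¹ ξ₁⁆,
          ζ₃ + Ad y⁻¹ ξ₃ - (2 : ℝ) • ⁅ζ₁, Ad y⁻¹ ξ₂⁆ - ⁅ζ₂, Ad y⁻¹ ξ₁⁆
            + ⁅ζ₁, ⁅ζ₁, Ad y⁻¹ ξ₁⁆⁆)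
    ∃ inv : G × L × L × L → G × L × L × L,
      (∀ a b c, mul3 (mul3 a b) c = mul3 a (mul3 b c)) ∧
      (∀ a, mul3 (1, 0, 0, 0) a = a) ∧
      (∀ a, mul3 a (1, 0, 0, 0) = a) ∧
      (∀ a, mul3 (inv a) a = (1, 0, 0, 0)) ∧
      (∀ a, mul3 a (inv a) = (1, 0, 0, 0)) := by
  intro mul3
  have hcancel : ∀ (x : G) (ξ : L), Ad x⁻¹ (Ad x ξ) = ξ := fun x ξ => by
    rw [← LinearMap.comp_apply, ← hAd_mul, inv_mul_cancel, hAd_one, LinearMap.id_apply]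
  refine ⟨fun a => (a.1⁻¹, -Ad a.1 a.2.1, -Ad a.1 a.2.2.1,
    -Ad a.1 a.2.2.2 - ⁅Ad a.1 a.2.1, Ad a.1 a.2.2.1⁆), ?_, ?_, ?_, ?_, ?_⟩
  · rintro ⟨x, ξ₁, ξ₂, ξ₃⟩ ⟨y, ζ₁, ζ₂, ζ₃⟩ ⟨z, η₁, η₂, η₃⟩
    simp only [mul3, Prod.mk.injEq, mul_assoc, mul_inv_rev, hAd_mul, LinearMap.comp_apply,
      map_add, map_sub, hAd_br, lie_add, add_lie, lie_sub, sub_lie,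
      lie_lie, two_smul, true_and]
    refine ⟨?_, ?_, ?_⟩ <;> abel
  · rintro ⟨x, ξ₁, ξ₂, ξ₃⟩
    simp [mul3]
  · rintro ⟨x, ξ₁, ξ₂, ξ₃⟩
    simp [mul3, hAd_one]
  · rintro ⟨x, ξ₁, ξ₂, ξ₃⟩
    simp only [mul3, Prod.mk.injEq, inv_mul_cancel, map_neg, map_sub, hAd_br, hcancel,
      lie_neg, lie_self, two_smul, ← lie_skew ξ₁ ξ₂, lie_zero, neg_zero, true_and]
    refine ⟨?_, ?_, ?_⟩ <;> abel
  · rintro ⟨x, ξ₁, ξ₂, ξ₃⟩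
    simp only [mul3, Prod.mk.injEq, mul_inv_cancel, inv_inv, neg_lie, lie_self,
      two_smul, ← lie_skew (Ad x ξ₁) (Ad x ξ₂), lie_zero, neg_zero, true_and]
    refine ⟨?_, ?_, ?_⟩ <;> abel
end

section
/- Let G be a group acting on a real Lie algebra 𝔤 by Lie algebra automorphisms, g ↦ Ad_g. Then the set G×𝔤⁴ is a group under the multiplication (x,ξ₁,ξ₂,ξ₃,ξ₄)(y,ζ₁,ζ₂,ζ₃,ζ₄) = (xy, ζ₁ + Ad_{y⁻¹}ξ₁, ζ₂ + Ad_{y⁻¹}ξ₂ − ad_{ζ₁}Ad_{y⁻¹}ξ₁, ζ₃ + Ad_{y⁻¹}ξ₃ − 2ad_{ζ₁}Ad_{y⁻¹}ξ₂ − ad_{ζ₂}Ad_{y⁻¹}ξ₁ + ad²_{ζ₁}Ad_{y⁻¹}ξ₁, ζ₄ + Ad_{y⁻¹}ξ₄ − 3ad_{ζ₁}Ad_{y⁻¹}ξ₃ − 3ad_{ζ₂}Ad_{y⁻¹}ξ₂ + 3ad²_{ζ₁}Ad_{y⁻¹}ξ₂ + 2ad_{ζ₂}ad_{ζ₁}Ad_{y⁻¹}ξ₁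 + ad_{ζ₁}ad_{ζ₂}Ad_{y⁻¹}ξ₁ − ad_{ζ₃}Ad_{y⁻¹}ξ₁ − ad³_{ζ₁}Ad_{y⁻¹}ξ₁), with unit (e,0,0,0,0). (This is the left-trivialized fourth order tangent group T⁴G.) -/
/-- For a group G acting on a real Lie algebra 𝔤 by Lie algebra
automorphisms, the set G×𝔤⁴ is a group under the left-trivialized fourth
order tangent group multiplication, with unit (e,0,0,0,0). -/
theorem fourth_order_tangent_group_is_group
    {G : Type*} [Group G] {L : Type*} [LieRing L] [LieAlgebra ℝ L]
    (Ad : G → L →ₗ[ℝ] L)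
    (hAd_mul : ∀ x y : G, Ad (x * y) = (Ad x).comp (Ad y))
    (hAd_one : Ad 1 = LinearMap.id)
    (hAd_br : ∀ (x : G) (ξ ζ : L), Ad x ⁅ξ, ζ⁆ = ⁅Ad x ξ, Ad x ζ⁆) :
    let mul4 : G × L × L × L × L → G × L × L × L × L → G × L × L × L × L :=
      fun a b =>
        match a, b with
        | (x, ξ₁, ξ₂, ξ₃, ξ₄), (y, ζ₁, ζ₂, ζ₃, ζ₄) =>
          (x * y,
            ζ₁ + Ad y⁻¹ ξ₁,
            ζ₂ + Ad y⁻¹ ξ₂ - ⁅ζ₁, Ad y⁻¹ ξ₁⁆,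
            ζ₃ + Ad y⁻¹ ξ₃ - (2 : ℝ) • ⁅ζ₁, Ad y⁻¹ ξ₂⁆ - ⁅ζ₂, Ad y⁻¹ ξ₁⁆
              + ⁅ζ₁, ⁅ζ₁, Ad y⁻¹ ξ₁⁆⁆,
            ζ₄ + Ad y⁻¹ ξ₄ - (3 : ℝ) • ⁅ζ₁, Ad y⁻¹ ξ₃⁆
              - (3 : ℝ) • ⁅ζ₂, Ad y⁻¹ ξ₂⁆ + (3 : ℝ) • ⁅ζ₁, ⁅ζ₁, Ad y⁻¹ ξ₂⁆⁆
              + (2 : ℝ) • ⁅ζ₂, ⁅ζ₁, Ad y⁻¹ ξ₁⁆⁆ + ⁅ζ₁, ⁅ζ₂, Ad y⁻¹ ξ₁⁆⁆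
              - ⁅ζ₃, Ad y⁻¹ ξ₁⁆ - ⁅ζ₁, ⁅ζ₁, ⁅ζ₁, Ad y⁻¹ ξ₁⁆⁆⁆)
    ∃ inv : G × L × L × L × L → G × L × L × L × L,
      (∀ a b c, mul4 (mul4 a b) c = mul4 a (mul4 b c)) ∧
      (∀ a, mul4 (1, 0, 0, 0, 0) a = a) ∧
      (∀ a, mul4 a (1, 0, 0, 0, 0) = a) ∧
      (∀ a, mul4 (inv a) a = (1, 0, 0, 0, 0)) ∧
      (∀ a, mul4 a (inv a) = (1, 0, 0, 0, 0)) := by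
  intro mul4
  have assoc : ∀ a b c, mul4 (mul4 a b) c = mul4 a (mul4 b c) := by
    rintro ⟨x, ξ₁, ξ₂, ξ₃, ξ₄⟩ ⟨y, ζ₁, ζ₂, ζ₃, ζ₄⟩ ⟨z, η₁, η₂, η₃, η₄⟩
    simp only [mul4, Prod.mk.injEq, mul_inv_rev, hAd_mul, LinearMap.comp_apply, map_add, map_sub,
      map_smul, hAd_br, lie_add, lie_sub, add_lie, sub_lie, lie_smul, smul_lie, lie_lie, smul_sub,
      smul_add]
    refine ⟨mul_assoc _ _ _, ?_, ?_, ?_, ?_⟩ <;> module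
  have one_mul4 : ∀ a, mul4 (1, 0, 0, 0, 0) a = a := by
    rintro ⟨x, ξ₁, ξ₂, ξ₃, ξ₄⟩
    simp [mul4]
  have mul4_one : ∀ a, mul4 a (1, 0, 0, 0, 0) = a := by
    rintro ⟨x, ξ₁, ξ₂, ξ₃, ξ₄⟩
    simp [mul4, hAd_one]
  have exists_right_inv : ∀ a, ∃ b, mul4 a b = (1, 0, 0, 0, 0) := by
    rintro ⟨x, ξ₁, ξ₂, ξ₃, ξ₄⟩
    obtain ⟨ζ₁, h₁⟩ : ∃ ζ₁, ζ₁ = -Ad x ξ₁ := ⟨_, rfl⟩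
    obtain ⟨ζ₂, h₂⟩ : ∃ ζ₂, ζ₂ = -(Ad x ξ₂ - ⁅ζ₁, Ad x ξ₁⁆) := ⟨_, rfl⟩
    obtain ⟨ζ₃, h₃⟩ : ∃ ζ₃, ζ₃ = -(Ad x ξ₃ - (2 : ℝ) • ⁅ζ₁, Ad x ξ₂⁆ - ⁅ζ₂, Ad x ξ₁⁆
        + ⁅ζ₁, ⁅ζ₁, Ad x ξ₁⁆⁆) := ⟨_, rfl⟩
    refine ⟨(x⁻¹, ζ₁, ζ₂, ζ₃, -(Ad x ξ₄ - (3 : ℝ) • ⁅ζ₁, Ad x ξ₃⁆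
        - (3 : ℝ) • ⁅ζ₂, Ad x ξ₂⁆ + (3 : ℝ) • ⁅ζ₁, ⁅ζ₁, Ad x ξ₂⁆⁆
        + (2 : ℝ) • ⁅ζ₂, ⁅ζ₁, Ad x ξ₁⁆⁆ + ⁅ζ₁, ⁅ζ₂, Ad x ξ₁⁆⁆
        - ⁅ζ₃, Ad x ξ₁⁆ - ⁅ζ₁, ⁅ζ₁, ⁅ζ₁, Ad x ξ₁⁆⁆⁆)), ?_⟩
    simp only [mul4, inv_inv, Prod.mk.injEq]
    refine ⟨mul_inv_cancel x, ?_, ?_, ?_, by module⟩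
    · rw [h₁]
      module
    · rw [h₂]
      module
    · rw [h₃]
      module
  choose inv mul4_inv using exists_right_inv
  refine ⟨inv, assoc, one_mul4, mul4_one, fun a => ?_, mul4_inv⟩
  have inv_inv_eq : inv (inv a) = a := by
    rw [← one_mul4 (inv (inv a)), ← mul4_inv a, assoc, mul4_inv (inv a), mul4_one]
  simpa only [inv_inv_eq] using mul4_inv (inv a)
end

section
/- Let G be a group acting on a real Lie algebra 𝔤 by Lie algebra automorphisms, and let T³G = G×𝔤³ carry the group multiplication (x,ξ₁,ξ₂,ξ₃)(y,ζ₁,ζ₂,ζ₃) = (xy, ζ₁ + Ad_{y⁻¹}ξ₁, ζ₂ + Ad_{y⁻¹}ξ₂ − ad_{ζ₁}Ad_{y⁻¹}ξ₁, ζ₃ + Ad_{y⁻¹}ξ₃ − 2ad_{ζ₁}Ad_{y⁻¹}ξ₂ − ad_{ζ₂}Ad_{y⁻¹}ξ₁ + ad²_{ζ₁}Ad_{y⁻¹}ξ₁) with unit (e,0,0,0). Then the inverse of (x,ξ₁,ξ₂,ξ₃) in T³G is (x⁻¹, −Ad_xξ₁, −Ad_xξ₂, −Ad_x(ξ₃ +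 [ξ₁,ξ₂])). -/
/-- In the left-trivialized third order tangent group
T³G = G×𝔤³ with unit (e,0,0,0), the inverse of (x,ξ₁,ξ₂,ξ₃) is
(x⁻¹, −Ad_xξ₁, −Ad_xξ₂, −Ad_x(ξ₃ + [ξ₁,ξ₂])). -/
theorem third_order_tangent_group_inverse
    {G : Type*} [Group G] {L : Type*} [LieRing L] [LieAlgebra ℝ L]
    (Ad : G → L →ₗ[ℝ] L)
    (hAd_mul : ∀ x y : G, Ad (x * y) = (Ad x).comp (Ad y))
    (hAd_one : Ad 1 = LinearMap.id)
    (hAd_br : ∀ (x : G) (ξ ζ : L), Ad x ⁅ξ, ζ⁆ = ⁅Ad x ξ, Ad x ζ⁆) :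
    let mul3 : G × L × L × L → G × L × L × L → G × L × L × L := fun a b =>
      match a, b with
      | (x, ξ₁, ξ₂, ξ₃), (y, ζ₁, ζ₂, ζ₃) =>
        (x * y,
          ζ₁ + Ad y⁻¹ ξ₁,
          ζ₂ + Ad y⁻¹ ξ₂ - ⁅ζ₁, Ad y⁻¹ ξ₁⁆,
          ζ₃ + Ad y⁻¹ ξ₃ - (2 : ℝ) • ⁅ζ₁, Ad y⁻¹ ξ₂⁆ - ⁅ζ₂, Ad y⁻¹ ξ₁⁆
            + ⁅ζ₁, ⁅ζ₁, Ad y⁻¹ ξ₁⁆⁆)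
    ∀ (x : G) (ξ₁ ξ₂ ξ₃ : L),
      mul3 (x, ξ₁, ξ₂, ξ₃)
          (x⁻¹, -Ad x ξ₁, -Ad x ξ₂, -Ad x (ξ₃ + ⁅ξ₁, ξ₂⁆))
        = (1, 0, 0, 0) ∧
      mul3 (x⁻¹, -Ad x ξ₁, -Ad x ξ₂, -Ad x (ξ₃ + ⁅ξ₁, ξ₂⁆))
          (x, ξ₁, ξ₂, ξ₃)
        = (1, 0, 0, 0) := by
  intro mul3 x ξ₁ ξ₂ ξ₃
  have hinv (ξ : L) : Ad x⁻¹ (Ad x ξ) = ξ := by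
    rw [← LinearMap.comp_apply, ← hAd_mul, inv_mul_cancel, hAd_one, LinearMap.id_apply]
  constructor
  · simp only [mul3, inv_inv, mul_inv_cancel, Prod.mk.injEq, true_and, map_add, hAd_br,
      neg_lie, lie_self, two_smul]
    refine ⟨by abel, by abel, ?_⟩
    rw [← lie_skew (Ad x ξ₂) (Ad x ξ₁)]
    simp only [neg_zero, lie_zero]
    abel
  · simp only [mul3, inv_mul_cancel, Prod.mk.injEq, true_and, map_neg, hinv,
      lie_neg, lie_self, two_smul]
    refine ⟨by abel, by abel, ?_⟩
    rw [← lie_skew ξ₂ ξ₁]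
    simp only [neg_zero, lie_zero]
    abel
end

section
/- Let G be a group acting on a real Lie algebra 𝔤 by Lie algebra automorphisms. Write i: 𝔤⁴ → T⁽³⁾G, (X₁,X₂,X₂₁,X₃₁) ↦ (e, X₁, X₂, X₂₁, 0, X₃₁, 0, 0), and j: T³G → T⁽³⁾G, (x,ξ₁,ξ₂,ξ₃) ↦ (x, ξ₁, ξ₁, ξ₂, ξ₁, ξ₂, ξ₂, ξ₃). Then the map 𝔤⁴ × T³G → T⁽³⁾G, ((X₁,X₂,X₂₁,X₃₁), (x,ξ₁,ξ₂,ξ₃)) ↦ i(X₁,X₂,X₂₁,X₃₁)·j(x,ξ₁,ξ₂,ξ₃) (product taken in T⁽³⁾G) is a bijection; that is, every element of T⁽³⁾G factors uniquely as a product of an element of i(𝔤⁴) and an element of the subgroup j(T³G). Hence T⁽³⁾G is a cocycle double cross product 𝔤⁴⋈_γT³G. -/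
/-- Every element of T⁽³⁾G factors uniquely as a product
i(X)·j(t) with X ∈ 𝔤⁴, t ∈ T³G, where i(X₁,X₂,X₂₁,X₃₁) = (e,X₁,X₂,X₂₁,0,X₃₁,0,0)
and j(x,ξ₁,ξ₂,ξ₃) = (x,ξ₁,ξ₁,ξ₂,ξ₁,ξ₂,ξ₂,ξ₃); i.e. the map
𝔤⁴ × T³G → T⁽³⁾G, (X,t) ↦ i(X)·j(t) is a bijection. Hence T⁽³⁾G is a cocycle
double cross product 𝔤⁴⋈_γT³G. -/
theorem iterated_T3G_factors_as_cocycle_double_cross_product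
    {G : Type*} [Group G] {L : Type*} [LieRing L] [LieAlgebra ℝ L]
    (Ad : G → L →ₗ[ℝ] L)
    (hAd_mul : ∀ x y : G, Ad (x * y) = (Ad x).comp (Ad y))
    (hAd_one : Ad 1 = LinearMap.id)
    (hAd_br : ∀ (x : G) (ξ ζ : L), Ad x ⁅ξ, ζ⁆ = ⁅Ad x ξ, Ad x ζ⁆) :
    let mul3 : G × L × L × L → G × L × L × L → G × L × L × L := fun a b =>
      match a, b with
      | (x, ξ₁, ξ₂, ξ₃), (y, ζ₁, ζ₂, ζ₃) =>
        (x * y,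
          ζ₁ + Ad y⁻¹ ξ₁,
          ζ₂ + Ad y⁻¹ ξ₂ - ⁅ζ₁, Ad y⁻¹ ξ₁⁆,
          ζ₃ + Ad y⁻¹ ξ₃ - (2 : ℝ) • ⁅ζ₁, Ad y⁻¹ ξ₂⁆ - ⁅ζ₂, Ad y⁻¹ ξ₁⁆
            + ⁅ζ₁, ⁅ζ₁, Ad y⁻¹ ξ₁⁆⁆)
    let mulIt : G × L × L × L × L × L × L × L →
        G × L × L × L × L × L × L × L → G × L × L × L × L × L × L × L :=
      fun a b =>
        match a, b with
        | (x, X1, X2, X21, X3, X31, X32, X321),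
          (y, Y1, Y2, Y21, Y3, Y31, Y32, Y321) =>
          (x * y,
            Y1 + Ad y⁻¹ X1,
            Y2 + Ad y⁻¹ X2,
            Y21 + Ad y⁻¹ X21 - ⁅Y1, Ad y⁻¹ X2⁆,
            Y3 + Ad y⁻¹ X3,
            Y31 + Ad y⁻¹ X31 - ⁅Y1, Ad y⁻¹ X3⁆,
            Y32 + Ad y⁻¹ X32 - ⁅Y2, Ad y⁻¹ X3⁆,
            Y321 + Ad y⁻¹ X321 - ⁅Y1, Ad y⁻¹ X32⁆ - ⁅Y2, Ad y⁻¹ X31⁆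
              + ⁅Y2, ⁅Y1, Ad y⁻¹ X3⁆⁆)
    let j : G × L × L × L → G × L × L × L × L × L × L × L := fun a =>
      match a with
      | (x, ξ₁, ξ₂, ξ₃) => (x, ξ₁, ξ₁, ξ₂, ξ₁, ξ₂, ξ₂, ξ₃)
    let i : L × L × L × L → G × L × L × L × L × L × L × L := fun X =>
      match X with
      | (X1, X2, X21, X31) => ((1 : G), X1, X2, X21, 0, X31, 0, 0)
    Function.Bijective
      (fun p : (L × L × L × L) × (G × L × L × L) => mulIt (i p.1) (j p.2)) := by
  intro mul3 mulIt j i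
  have hl (z : G) (v : L) : Ad z (Ad z⁻¹ v) = v := by
    simpa [hAd_one] using (LinearMap.congr_fun (hAd_mul z z⁻¹) v).symm
  have hr (z : G) (v : L) : Ad z⁻¹ (Ad z v) = v := by
    simpa [hAd_one] using (LinearMap.congr_fun (hAd_mul z⁻¹ z) v).symm
  refine Function.bijective_iff_has_inverse.mpr
    ⟨fun (z, Z1, Z2, Z21, Z3, Z31, Z32, Z321) =>
      ((Ad z (Z1 - Z3), Ad z (Z2 - Z3), Ad z (Z21 - Z32 + ⁅Z3, Z2 - Z3⁆), Ad z (Z31 - Z32)),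
        (z, Z3, Z32, Z321 + ⁅Z3, Z31 - Z32⁆)), ?_, ?_⟩
  · rintro ⟨⟨X1, X2, X21, X31⟩, x, ξ₁, ξ₂, ξ₃⟩
    simp only [mulIt, i, j, one_mul, map_zero, add_zero, lie_zero, sub_zero,
      add_sub_cancel_left, add_sub_assoc, sub_add_cancel, hl]
  · rintro ⟨z, Z1, Z2, Z21, Z3, Z31, Z32, Z321⟩
    simp only [mulIt, i, j, one_mul, map_zero, add_zero, lie_zero, sub_zero, hr,
      add_sub_cancel, add_sub_cancel_right, ← add_assoc]
end

section
/- Let 𝔤 be a Lie algebra over ℝ and B a real constant. Then the bracket on 𝔤×𝔤×𝔤×𝔤 defined by [(v,β,w,α),(v′,β′,w′,α′)] = ( [α,v′] + [v,α′], [α,β′] + [β,α′], [α,w′] + [w,α′] − B([β,v′] + [v,β′]), [α,α′] ) is a Lie bracket (bilinear, alternating, and satisfying the Jacobi identity). This is the Lie algebra underlying the Hamiltonian four-field model of two-dimensional compressible reduced magnetohydrodynamics, realized as a cocycle double cross sum (𝔤⊕𝔤)⋈_θ(𝔤⊕𝔤). -/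
/-- For a real Lie algebra 𝔤 and a real constant B, the bracket
on 𝔤×𝔤×𝔤×𝔤 given by
[(v,β,w,α),(v′,β′,w′,α′)] = ([α,v′]+[v,α′], [α,β′]+[β,α′],
 [α,w′]+[w,α′]−B([β,v′]+[v,β′]), [α,α′])
is a Lie bracket (bilinear, alternating, Jacobi): the Lie algebra underlying
the Hamiltonian four-field model of two-dimensional compressible reduced
magnetohydrodynamics, realized as a cocycle double cross sum
(𝔤⊕𝔤)⋈_θ(𝔤⊕𝔤). -/
theorem four_field_model_bracket_is_lie
    {L : Type*} [LieRing L] [LieAlgebra ℝ L] (B : ℝ) :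
    let Br : (L × L × L × L) → (L × L × L × L) → (L × L × L × L) := fun p q =>
      match p, q with
      | (v, β, w, α), (v', β', w', α') =>
        (⁅α, v'⁆ + ⁅v, α'⁆,
          ⁅α, β'⁆ + ⁅β, α'⁆,
          ⁅α, w'⁆ + ⁅w, α'⁆ - B • (⁅β, v'⁆ + ⁅v, β'⁆),
          ⁅α, α'⁆)
    (∀ (a : ℝ) (x y z : L × L × L × L),
        Br (x + y) z = Br x z + Br y z ∧ Br x (y + z) = Br x y + Br x z ∧
        Br (a • x) y = a • Br x y ∧ Br x (a • y) = a • Br x y) ∧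
    (∀ x : L × L × L × L, Br x x = 0) ∧
    (∀ x y z : L × L × L × L,
        Br x (Br y z) + Br y (Br z x) + Br z (Br x y) = 0) := by
  refine ⟨?_, ?_, ?_⟩
  · rintro a ⟨v₁, β₁, w₁, α₁⟩ ⟨v₂, β₂, w₂, α₂⟩ ⟨v₃, β₃, w₃, α₃⟩
    refine ⟨?_, ?_, ?_, ?_⟩ <;>
      simp only [Prod.mk_add_mk, Prod.smul_mk, Prod.mk.injEq, add_lie, lie_add, smul_lie,
        lie_smul, and_true] <;>
      refine ⟨?_, ?_, ?_⟩ <;> module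
  · rintro ⟨v, β, w, α⟩
    have lie_add_lie_swap (x y : L) : ⁅x, y⁆ + ⁅y, x⁆ = 0 := by
      rw [← lie_skew x y, neg_add_cancel]
    simp [lie_add_lie_swap, -smul_add]
  · rintro ⟨v₁, β₁, w₁, α₁⟩ ⟨v₂, β₂, w₂, α₂⟩ ⟨v₃, β₃, w₃, α₃⟩
    simp only [Prod.mk_add_mk, Prod.mk_eq_zero, lie_add, lie_sub, lie_smul]
    refine ⟨?_, ?_, ?_, lie_jacobi α₁ α₂ α₃⟩
    · linear_combination (norm := module)
        lie_jacobi α₁ α₂ v₃ + lie_jacobi α₁ v₂ α₃ + lie_jacobi v₁ α₂ α₃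
    · linear_combination (norm := module)
        lie_jacobi α₁ α₂ β₃ + lie_jacobi α₁ β₂ α₃ + lie_jacobi β₁ α₂ α₃
    · linear_combination (norm := module)
        lie_jacobi α₁ α₂ w₃ + lie_jacobi α₁ w₂ α₃ + lie_jacobi w₁ α₂ α₃
          - B • (lie_jacobi α₁ β₂ v₃ + lie_jacobi α₁ v₂ β₃ + lie_jacobi β₁ α₂ v₃
            + lie_jacobi v₁ α₂ β₃ + lie_jacobi β₁ v₂ α₃ + lie_jacobi v₁ β₂ α₃)
end

section
/- Let 𝔤 be a finite-dimensional real Lie algebra with dual 𝔤*, and for ξ∈𝔤 let ad*_ξ: 𝔤*→𝔤* be defined by ⟨ad*_ξμ, ζ⟩ = −⟨μ,[ξ,ζ]⟩. Let η₀: ℝ→𝔤 be a smooth curve and set η₁ = η₀′ and η₂ = η₁′. Suppose μ₀, μ₁, μ₂: ℝ→𝔤* are smooth curves satisfying the third order Euler–Poincaré system: μ₀′ = −ad*_{η₀}μ₀ − ad*_{η₁}μ₁ − ad*_{η₂}μ₂, μ₁′ = −ad*_{η₀}μ₁ − 2ad*_{η₁}μ₂, and μ₂′ = −ad*_{η₀}μ₂.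 Then (d/dt + ad*_{η₀})(μ₀ − μ₁′ + μ₂″) = 0, i.e. μ₀′ − μ₁″ + μ₂‴ + ad*_{η₀}(μ₀ − μ₁′ + μ₂″) = 0 for all t. -/
/-- Product rule for the duality pairing of a weak-* differentiable curve of functionals with a
weakly differentiable curve of vectors in a finite-dimensional space. -/
theorem hasDerivAt_dual_apply {V : Type*} [AddCommGroup V] [Module ℝ V] [FiniteDimensional ℝ V]
    {v v' : ℝ → V} {μ μ' : ℝ → Module.Dual ℝ V} {t : ℝ}
    (hv : ∀ φ : Module.Dual ℝ V, HasDerivAt (fun s => φ (v s)) (φ (v' t)) t)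
    (hμ : ∀ x : V, HasDerivAt (fun s => μ s x) (μ' t x) t) :
    HasDerivAt (fun s => μ s (v s)) (μ' t (v t) + μ t (v' t)) t := by
  let b := Module.finBasis ℝ V
  have expand (φ : Module.Dual ℝ V) (x : V) : φ x = ∑ i, b.coord i x * φ (b i) := by
    conv_lhs => rw [← b.sum_repr x, map_sum]
    simp only [map_smul, smul_eq_mul, Module.Basis.coord_apply]
  have hsum : HasDerivAt (fun s => ∑ i, b.coord i (v s) * μ s (b i))
      (∑ i, (b.coord i (v' t) * μ t (b i) + b.coord i (v t) * μ' t (b i))) t :=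
    HasDerivAt.fun_sum fun i _ => (hv (b.coord i)).mul (hμ (b i))
  rw [Finset.sum_add_distrib, ← expand, ← expand, add_comm] at hsum
  simpa only [← expand] using hsum

/-- Product rule for the pairing `⟨μ, [η, ζ]⟩` with `ζ` fixed. -/
theorem hasDerivAt_dual_lie {L : Type*} [LieRing L] [LieAlgebra ℝ L] [FiniteDimensional ℝ L]
    {η η' : ℝ → L} {μ μ' : ℝ → Module.Dual ℝ L} {t : ℝ}
    (hη : ∀ φ : Module.Dual ℝ L, HasDerivAt (fun s => φ (η s)) (φ (η' t)) t)
    (hμ : ∀ x : L, HasDerivAt (fun s => μ s x) (μ' t x) t) (ζ : L) :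
    HasDerivAt (fun s => μ s ⁅η s, ζ⁆) (μ' t ⁅η t, ζ⁆ + μ t ⁅η' t, ζ⁆) t := by
  refine hasDerivAt_dual_apply (v := fun s => ⁅η s, ζ⁆) (v' := fun s => ⁅η' s, ζ⁆) (fun φ => ?_) hμ
  have h := (hη (φ ∘ₗ (LieAlgebra.ad ℝ L ζ : L →ₗ[ℝ] L))).neg
  simpa [Pi.neg_def, ← map_neg, lie_skew] using h

/-- For a finite-dimensional real Lie algebra 𝔤 with coadjoint
map ad*_ξ on 𝔤* (⟨ad*_ξμ,ζ⟩ = −⟨μ,[ξ,ζ]⟩), smooth curves η₀ in 𝔤 with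
η₁ = η₀′, η₂ = η₁′, and curves μ₀, μ₁, μ₂ in 𝔤* (with derivatives dμ₀, dμ₁,
ddμ₁, dμ₂, ddμ₂, dddμ₂, taken pointwise against 𝔤) satisfying the third order
Euler–Poincaré system
μ₀′ = −ad*_{η₀}μ₀ − ad*_{η₁}μ₁ − ad*_{η₂}μ₂,
μ₁′ = −ad*_{η₀}μ₁ − 2ad*_{η₁}μ₂,
μ₂′ = −ad*_{η₀}μ₂,
one has (d/dt + ad*_{η₀})(μ₀ − μ₁′ + μ₂″) = 0. -/
theorem third_order_euler_poincare_reduction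
    {L : Type*} [LieRing L] [LieAlgebra ℝ L] [FiniteDimensional ℝ L]
    (η₀ η₁ η₂ : ℝ → L)
    (μ₀ μ₁ μ₂ dμ₀ dμ₁ ddμ₁ dμ₂ ddμ₂ dddμ₂ : ℝ → Module.Dual ℝ L)
    -- the coadjoint action ad*_ξ on 𝔤*
    (coad : L → Module.Dual ℝ L → Module.Dual ℝ L)
    (hcoad : ∀ (ξ : L) (μ : Module.Dual ℝ L) (ζ : L), coad ξ μ ζ = -μ ⁅ξ, ζ⁆)
    -- η₁ = η₀′ and η₂ = η₁′ (weakly, i.e. paired against any functional)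
    (hη₁ : ∀ (μ : Module.Dual ℝ L) (t : ℝ),
      HasDerivAt (fun s => μ (η₀ s)) (μ (η₁ t)) t)
    (hη₂ : ∀ (μ : Module.Dual ℝ L) (t : ℝ),
      HasDerivAt (fun s => μ (η₁ s)) (μ (η₂ t)) t)
    -- derivatives of the momenta (weak-* derivatives)
    (hdμ₀ : ∀ (ζ : L) (t : ℝ), HasDerivAt (fun s => μ₀ s ζ) (dμ₀ t ζ) t)
    (hdμ₁ : ∀ (ζ : L) (t : ℝ), HasDerivAt (fun s => μ₁ s ζ) (dμ₁ t ζ) t)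
    (hddμ₁ : ∀ (ζ : L) (t : ℝ), HasDerivAt (fun s => dμ₁ s ζ) (ddμ₁ t ζ) t)
    (hdμ₂ : ∀ (ζ : L) (t : ℝ), HasDerivAt (fun s => μ₂ s ζ) (dμ₂ t ζ) t)
    (hddμ₂ : ∀ (ζ : L) (t : ℝ), HasDerivAt (fun s => dμ₂ s ζ) (ddμ₂ t ζ) t)
    (hdddμ₂ : ∀ (ζ : L) (t : ℝ), HasDerivAt (fun s => ddμ₂ s ζ) (dddμ₂ t ζ) t)
    -- the third order Euler–Poincaré system
    (hsys₀ : ∀ t, dμ₀ t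
      = -(coad (η₀ t) (μ₀ t)) - coad (η₁ t) (μ₁ t) - coad (η₂ t) (μ₂ t))
    (hsys₁ : ∀ t, dμ₁ t
      = -(coad (η₀ t) (μ₁ t)) - (2 : ℝ) • coad (η₁ t) (μ₂ t))
    (hsys₂ : ∀ t, dμ₂ t = -(coad (η₀ t) (μ₂ t))) :
    ∀ t, dμ₀ t - ddμ₁ t + dddμ₂ t
      + coad (η₀ t) (μ₀ t - dμ₁ t + ddμ₂ t) = 0 := by
  intro t
  ext ζ
  have hμ₁_eq (s : ℝ) : dμ₁ s ζ = μ₁ s ⁅η₀ s, ζ⁆ + 2 * μ₂ s ⁅η₁ s, ζ⁆ := by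
    simp [hsys₁, hcoad]
  have hμ₀_eq : dμ₀ t ζ = μ₀ t ⁅η₀ t, ζ⁆ + μ₁ t ⁅η₁ t, ζ⁆ + μ₂ t ⁅η₂ t, ζ⁆ := by
    simp [hsys₀, hcoad]
  have hddμ₂_eq (x : L) (s : ℝ) : ddμ₂ s x = dμ₂ s ⁅η₀ s, x⁆ + μ₂ s ⁅η₁ s, x⁆ := by
    refine (hddμ₂ x s).unique ?_
    have hfun : (fun r => dμ₂ r x) = fun r => μ₂ r ⁅η₀ r, x⁆ := by
      funext r
      simp [hsys₂, hcoad]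
    rw [hfun]
    exact hasDerivAt_dual_lie (hη₁ · s) (hdμ₂ · s) x
  have hdddμ₂_eq : dddμ₂ t ζ = (ddμ₂ t ⁅η₀ t, ζ⁆ + dμ₂ t ⁅η₁ t, ζ⁆)
      + (dμ₂ t ⁅η₁ t, ζ⁆ + μ₂ t ⁅η₂ t, ζ⁆) := by
    refine (hdddμ₂ ζ t).unique ?_
    simp only [hddμ₂_eq ζ]
    exact (hasDerivAt_dual_lie (hη₁ · t) (hddμ₂ · t) ζ).add
      (hasDerivAt_dual_lie (hη₂ · t) (hdμ₂ · t) ζ)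
  have hddμ₁_eq : ddμ₁ t ζ = (dμ₁ t ⁅η₀ t, ζ⁆ + μ₁ t ⁅η₁ t, ζ⁆)
      + 2 * (dμ₂ t ⁅η₁ t, ζ⁆ + μ₂ t ⁅η₂ t, ζ⁆) := by
    refine (hddμ₁ ζ t).unique ?_
    simp only [hμ₁_eq]
    exact (hasDerivAt_dual_lie (hη₁ · t) (hdμ₁ · t) ζ).add
      ((hasDerivAt_dual_lie (hη₂ · t) (hdμ₂ · t) ζ).const_mul 2)
  simp only [LinearMap.add_apply, LinearMap.sub_apply, LinearMap.zero_apply, hcoad]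
  rw [hμ₀_eq, hddμ₁_eq, hdddμ₂_eq]
  ring
end
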